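/- Let C₀ > 0 and κ > 0 be constants and let C : [0,∞) → ℝ be the exponentially decreasing transaction costs function C(ξ) = C₀ e^{-κξ}. Then its mean value modification satisfies, for all ξ ≥ 0, C̃(ξ) = C₀ (1 − κξ e^{κ²ξ²/2} ∫_{κξ}^∞ e^{-t²/2} dt). -/

import Mathlib

open MeasureTheory Real

/-- The mean value modification of a transaction costs function `C`:
`C̃(ξ) = ∫₀^∞ C(ξx) x e^{-x²/2} dx`. -/
noncomputable def tildeC (C : ℝ → ℝ) (ξ : ℝ) : ℝ :=
  ∫ x in Set.Ioi (0:ℝ), C (ξ * x) * x * Real.exp (-x ^ 2 / 2)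

theorem integrable_exp_neg_sq_div_two : Integrable fun t : ℝ => Real.exp (-t ^ 2 / 2) := by
  convert integrable_exp_neg_mul_sq (b := 1 / 2) (by norm_num) using 3
  ring

theorem integrable_mul_exp_neg_sq_div_two :
    Integrable fun t : ℝ => t * Real.exp (-t ^ 2 / 2) := by
  convert integrable_mul_exp_neg_mul_sq (b := 1 / 2) (by norm_num) using 4
  ring

theorem integral_Ioi_mul_exp_neg_sq_div_two (a : ℝ) :
    ∫ t in Set.Ioi a, t * Real.exp (-t ^ 2 / 2) = Real.exp (-a ^ 2 / 2) := by
  have hderiv (x : ℝ) :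
      HasDerivAt (fun t : ℝ => -Real.exp (-t ^ 2 / 2)) (x * Real.exp (-x ^ 2 / 2)) x := by
    have hexponent : HasDerivAt (fun t : ℝ => -t ^ 2 / 2) (-x) x :=
      ((hasDerivAt_pow 2 x).fun_neg.div_const 2).congr_deriv (by push_cast; ring)
    exact hexponent.exp.fun_neg.congr_deriv (by ring)
  have hlim : Filter.Tendsto (fun t : ℝ => -Real.exp (-t ^ 2 / 2)) Filter.atTop (nhds 0) := by
    rw [← neg_zero]
    refine (Real.tendsto_exp_atBot.comp ?_).neg
    refine Filter.Tendsto.atBot_div_const two_pos ?_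
    exact Filter.tendsto_neg_atTop_atBot.comp (Filter.tendsto_pow_atTop two_ne_zero)
  rw [integral_Ioi_of_hasDerivAt_of_tendsto' (fun x _ => hderiv x)
    integrable_mul_exp_neg_sq_div_two.integrableOn hlim]
  ring

theorem setIntegral_Ioi_comp_add_right (g : ℝ → ℝ) (a : ℝ) :
    ∫ x in Set.Ioi 0, g (x + a) = ∫ t in Set.Ioi a, g t := by
  have h := (measurePreserving_add_right volume a).setIntegral_preimage_emb
    (measurableEmbedding_addRight a) g (Set.Ioi a)
  simpa using h

/-- For the exponentially decreasing transaction costs function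
`C(ξ) = C₀ e^{-κξ}` with `C₀, κ > 0`, the mean value modification satisfies
`C̃(ξ) = C₀ (1 − κξ e^{κ²ξ²/2} ∫_{κξ}^∞ e^{-t²/2} dt)` for all `ξ ≥ 0`. -/
theorem tildeC_exponential (C₀ κ : ℝ) (hC₀ : 0 < C₀) (hκ : 0 < κ) :
    ∀ ξ ≥ (0:ℝ),
      tildeC (fun s => C₀ * Real.exp (-(κ * s))) ξ
        = C₀ * (1 - κ * ξ * Real.exp (κ ^ 2 * ξ ^ 2 / 2)
            * ∫ t in Set.Ioi (κ * ξ), Real.exp (-t ^ 2 / 2)) := by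
  intro ξ _
  have hsquare (x : ℝ) : C₀ * Real.exp (-(κ * (ξ * x))) * x * Real.exp (-x ^ 2 / 2)
      = C₀ * Real.exp (κ ^ 2 * ξ ^ 2 / 2) *
        ((x + κ * ξ) * Real.exp (-(x + κ * ξ) ^ 2 / 2)
          - κ * ξ * Real.exp (-(x + κ * ξ) ^ 2 / 2)) := by
    have h : Real.exp (-(κ * (ξ * x))) * Real.exp (-x ^ 2 / 2)
        = Real.exp (κ ^ 2 * ξ ^ 2 / 2) * Real.exp (-(x + κ * ξ) ^ 2 / 2) := by
      rw [← Real.exp_add, ← Real.exp_add]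
      ring_nf
    linear_combination C₀ * x * h
  have hcancel : Real.exp (κ ^ 2 * ξ ^ 2 / 2) * Real.exp (-(κ * ξ) ^ 2 / 2) = 1 := by
    rw [← Real.exp_add, Real.exp_eq_one_iff]
    ring
  simp only [tildeC, hsquare]
  rw [integral_const_mul, setIntegral_Ioi_comp_add_right
    (fun t => t * Real.exp (-t ^ 2 / 2) - κ * ξ * Real.exp (-t ^ 2 / 2)),
    integral_sub integrable_mul_exp_neg_sq_div_two.integrableOn
      (integrable_exp_neg_sq_div_two.const_mul _).integrableOn,
    integral_const_mul, integral_Ioi_mul_exp_neg_sq_div_two]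
  linear_combination C₀ * hcancel
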